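/- arXiv:2502.03762 — 7 statements merged into one kernel-verified Lean document; each statement's English description precedes it below -/
import Mathlib

section
/- Let S be a finite type, u_max ∈ ℕ, and let π : S → List AP → D be a prefix tree policy induced by a reward machine model A with at most u_max nodes via a product policy r, i.e. π(s,σ) = r(δ_A*(u_A,σ), s) for every feasible word σ and every s ∈ Reach(σ). Let B be a deterministic finite automaton over AP with at most u_max nodes, initial node u_B and transition δ_B, and set l = (Fintype.card S)·u_max². Then the following are equivalent: (i) for all feasible words σ, σ' of length at most l and every s ∈ Reach(σ) ∩ Reach(σ'), π(s,σ) ≠ π(s,σ') implies δ_B*(u_B,σ) ≠ δ_B*(u_B,σ'); (ii) for all feasible words σ, σ' of arbitrary length and every s ∈ Reach(σ) ∩ Reach(σ'), π(s,σ) ≠ π(s,σ') implies δ_B*(u_B,σ) ≠ δ_B*(u_B,σ'). (Proposition 2: separating all negative examples up to depth |S|·u_max² is equivalent to separating all negative examples of every depth.) -/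
/-- A trajectory of a labeled transition system: a nonempty list of states whose
head is an initial state and whose consecutive elements are related by `step`. -/
def IsTraj {S : Type*} (step : S → S → Prop) (S0 : Set S) (τ : List S) : Prop :=
  τ ≠ [] ∧ (∀ h : τ ≠ [], τ.head h ∈ S0) ∧ τ.Chain' step

/-- A word over `AP` is feasible if some trajectory generates it. -/
def Feasible {S AP : Type*} (step : S → S → Prop) (S0 : Set S) (L : S → AP)
    (σ : List AP) : Prop :=
  ∃ τ : List S, IsTraj step S0 τ ∧ τ.map L = σ

/-- The set of states at which some trajectory generating `σ` ends. -/
def Reach {S AP : Type*} (step : S → S → Prop) (S0 : Set S) (L : S → AP)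
    (σ : List AP) : Set S :=
  { s | ∃ τ : List S, IsTraj step S0 τ ∧ τ.map L = σ ∧ τ.getLast? = some s }

/-- Nonempty paths, listed from the last vertex back to the first, that start in `I` and
follow the relation `E`. -/
inductive RevPath {V : Type*} (I : V → Prop) (E : V → V → Prop) : List V → Prop
  | single {v : V} : I v → RevPath I E [v]
  | cons {v w : V} {l : List V} : RevPath I E (v :: l) → E v w → RevPath I E (w :: v :: l)

theorem RevPath.of_append {V : Type*} {I : V → Prop} {E : V → V → Prop} {v : V} {l : List V} :
    ∀ {m : List V}, RevPath I E (m ++ v :: l) → RevPath I E (v :: l)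
  | [], h => h
  | a :: m, h => by
    refine RevPath.of_append (m := m) ?_
    rw [List.cons_append] at h
    generalize hk : m ++ v :: l = k at h
    cases h with
    | single => simp at hk
    | cons h _ => exact h

theorem RevPath.exists_nodup_cons {V : Type*} {I : V → Prop} {E : V → V → Prop} {v w : V}
    {l : List V} (h : RevPath I E (v :: l)) (hl : (v :: l).Nodup) (hE : E v w) :
    ∃ l', RevPath I E (w :: l') ∧ (w :: l').Nodup := by
  by_cases hw : w ∈ v :: l
  · obtain ⟨a, b, hab⟩ := List.append_of_mem hw
    rw [hab] at h hl
    exact ⟨b, h.of_append, hl.of_append_right⟩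
  · exact ⟨v :: l, h.cons hE, List.nodup_cons.2 ⟨hw, hl⟩⟩

theorem isTraj_iff {S : Type*} {step : S → S → Prop} {S0 : Set S} {τ : List S} :
    IsTraj step S0 τ ↔ τ ≠ [] ∧ (∀ h : τ ≠ [], τ.head h ∈ S0) ∧ τ.IsChain step :=
  Iff.rfl

theorem isTraj_singleton {S : Type*} {step : S → S → Prop} {S0 : Set S} {s : S} :
    IsTraj step S0 [s] ↔ s ∈ S0 := by
  simp [isTraj_iff]

theorem isTraj_concat {S : Type*} {step : S → S → Prop} {S0 : Set S} {τ : List S} {t s : S}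
    (ht : τ.getLast? = some t) :
    IsTraj step S0 (τ ++ [s]) ↔ IsTraj step S0 τ ∧ step t s := by
  have hτ : τ ≠ [] := by rintro rfl; simp at ht
  simp [isTraj_iff, hτ, ht, List.isChain_append, and_assoc]

section Product

variable {S AP UA UB : Type*} (step : S → S → Prop) (S0 : Set S) (L : S → AP)
  (A : DFA AP UA) (B : DFA AP UB)

/-- Initial vertices of the product of a labeled transition system with two automata. -/
def ProductInit (v : S × UA × UB) : Prop :=
  v.1 ∈ S0 ∧ v.2.1 = A.step A.start (L v.1) ∧ v.2.2 = B.step B.start (L v.1)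

/-- Edges of the product of a labeled transition system with two automata. -/
def ProductStep (v w : S × UA × UB) : Prop :=
  step v.1 w.1 ∧ w.2.1 = A.step v.2.1 (L w.1) ∧ w.2.2 = B.step v.2.2 (L w.1)

variable {step S0 L A B}

theorem IsTraj.exists_nodup_revPath {τ : List S} (hτ : IsTraj step S0 τ) {s : S}
    (hs : τ.getLast? = some s) :
    ∃ l, RevPath (ProductInit S0 L A B) (ProductStep step L A B)
        ((s, A.evalFrom A.start (τ.map L), B.evalFrom B.start (τ.map L)) :: l) ∧
      ((s, A.evalFrom A.start (τ.map L), B.evalFrom B.start (τ.map L)) :: l).Nodup := by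
  induction τ using List.reverseRecOn generalizing s with
  | nil => simp at hs
  | append_singleton τ x ih =>
    obtain rfl : x = s := by simpa using hs
    cases ht : τ.getLast? with
    | none =>
      obtain rfl : τ = [] := by simpa using ht
      refine ⟨[], .single ?_, by simp⟩
      exact ⟨isTraj_singleton.1 hτ, by simp, by simp⟩
    | some t =>
      rw [isTraj_concat ht] at hτ
      obtain ⟨l, hl, hn⟩ := ih hτ.1 ht
      refine hl.exists_nodup_cons hn ⟨hτ.2, ?_, ?_⟩ <;> simp [DFA.evalFrom_append_singleton]

theorem RevPath.isTraj {v : S × UA × UB} {l : List (S × UA × UB)}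
    (h : RevPath (ProductInit S0 L A B) (ProductStep step L A B) (v :: l)) :
    ∃ τ : List S, IsTraj step S0 τ ∧ τ.getLast? = some v.1 ∧ τ.length = (v :: l).length ∧
      A.evalFrom A.start (τ.map L) = v.2.1 ∧ B.evalFrom B.start (τ.map L) = v.2.2 := by
  induction l generalizing v with
  | nil =>
    cases h with
    | single h => exact ⟨[v.1], isTraj_singleton.2 h.1, by simp, by simp, by simp [h.2.1],
        by simp [h.2.2]⟩
  | cons w l ih =>
    cases h with
    | cons h hE =>
      obtain ⟨τ, hτ, ht, hlen, hA, hB⟩ := ih h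
      refine ⟨τ ++ [v.1], (isTraj_concat ht).2 ⟨hτ, hE.1⟩, by simp, by simp [hlen], ?_, ?_⟩
      · simp [DFA.evalFrom_append_singleton, hA, hE.2.1]
      · simp [DFA.evalFrom_append_singleton, hB, hE.2.2]

/-- Every word reaching `s` can be replaced by a short one that reaches `s` and is not
distinguished from it by either automaton. -/
theorem exists_short_word_of_mem_reach [Fintype S] [Fintype UA] [Fintype UB]
    {σ : List AP} {s : S} (hs : s ∈ Reach step S0 L σ) :
    ∃ σ', s ∈ Reach step S0 L σ' ∧
      σ'.length ≤ Fintype.card S * (Fintype.card UA * Fintype.card UB) ∧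
      A.evalFrom A.start σ' = A.evalFrom A.start σ ∧
      B.evalFrom B.start σ' = B.evalFrom B.start σ := by
  obtain ⟨τ, hτ, rfl, hlast⟩ := hs
  obtain ⟨l, hl, hn⟩ := hτ.exists_nodup_revPath (L := L) (A := A) (B := B) hlast
  obtain ⟨τ', hτ', hlast', hlen, hA, hB⟩ := hl.isTraj
  refine ⟨τ'.map L, ⟨τ', hτ', rfl, hlast'⟩, ?_, hA, hB⟩
  rw [List.length_map, hlen, ← Fintype.card_prod, ← Fintype.card_prod]
  exact hn.length_le_card

theorem Feasible.of_mem_reach {σ : List AP} {s : S} (hs : s ∈ Reach step S0 L σ) :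
    Feasible step S0 L σ :=
  let ⟨τ, hτ, hσ, _⟩ := hs
  ⟨τ, hτ, hσ⟩

end Product

/-- Proposition 2: for a prefix tree policy induced by a reward machine model with at
most `u_max` nodes, a DFA `B` with at most `u_max` nodes separates all negative
examples up to depth `|S| * u_max ^ 2` iff it separates all negative examples of
every depth. -/
theorem prop2_sufficient_depth {S AP D UA UB : Type*}
    [Fintype S] [Fintype AP] [Fintype UA] [Fintype UB]
    (step : S → S → Prop) (S0 : Set S) (L : S → AP)
    (u_max : ℕ) (hA : Fintype.card UA ≤ u_max) (hB : Fintype.card UB ≤ u_max)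
    (A : DFA AP UA) (r : UA → S → D) (π : S → List AP → D)
    (hind : ∀ σ, Feasible step S0 L σ → ∀ s ∈ Reach step S0 L σ,
      π s σ = r (A.evalFrom A.start σ) s)
    (B : DFA AP UB) :
    (∀ σ σ', Feasible step S0 L σ → Feasible step S0 L σ' →
        σ.length ≤ Fintype.card S * u_max ^ 2 → σ'.length ≤ Fintype.card S * u_max ^ 2 →
        ∀ s, s ∈ Reach step S0 L σ → s ∈ Reach step S0 L σ' →
          π s σ ≠ π s σ' → B.evalFrom B.start σ ≠ B.evalFrom B.start σ') ↔
    (∀ σ σ', Feasible step S0 L σ → Feasible step S0 L σ' →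
        ∀ s, s ∈ Reach step S0 L σ → s ∈ Reach step S0 L σ' →
          π s σ ≠ π s σ' → B.evalFrom B.start σ ≠ B.evalFrom B.start σ') := by
  refine ⟨fun h σ σ' hσ hσ' s hs hs' hne => ?_, fun h σ σ' hσ hσ' _ _ => h σ σ' hσ hσ'⟩
  have hcard : Fintype.card S * (Fintype.card UA * Fintype.card UB) ≤
      Fintype.card S * u_max ^ 2 := by
    rw [sq]
    gcongr
  obtain ⟨ρ, hρ, hlen, hρA, hρB⟩ := exists_short_word_of_mem_reach (A := A) (B := B) hs
  obtain ⟨ρ', hρ', hlen', hρA', hρB'⟩ := exists_short_word_of_mem_reach (A := A) (B := B) hs'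
  have fρ := Feasible.of_mem_reach hρ
  have fρ' := Feasible.of_mem_reach hρ'
  rw [← hρB, ← hρB']
  refine h ρ ρ' fρ fρ' (hlen.trans hcard) (hlen'.trans hcard) s hρ hρ' ?_
  rwa [hind ρ fρ s hρ, hind ρ' fρ' s hρ', hρA, hρA', ← hind σ hσ s hs, ← hind σ' hσ' s hs']
end

section
/- Let A and B be deterministic finite automata over the alphabet AP, with node sets U_A and U_B of cardinalities m and n, initial nodes u_A and u_B, and transition functions δ_A and δ_B respectively. Then for every feasible word σ and every state s ∈ Reach(σ), there exists a feasible word σ̄ of length at most (Fintype.card S)·m·n such that s ∈ Reach(σ̄), δ_A*(u_A,σ̄) = δ_A*(u_A,σ), and δ_B*(u_B,σ̄) = δ_B*(u_B,σ). (Cycle removal in the product of the labeled transition system with the synchronized reward machine model: every jointly reached configuration is reached by a word of bounded length.) -/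
theorem IsTraj.take {S : Type*} {step : S → S → Prop} {S0 : Set S} {τ : List S}
    (h : IsTraj step S0 τ) (k : ℕ) : IsTraj step S0 (τ.take (k + 1)) := by
  obtain ⟨hne, hhead, hchain⟩ := h
  refine ⟨by simpa using hne, fun _ => ?_, List.IsChain.take hchain _⟩
  simpa [List.head_take] using hhead hne

theorem IsTraj.append_of_getLast?_eq {S : Type*} {step : S → S → Prop} {S0 : Set S}
    {p q r : List S} (hp : IsTraj step S0 p) (hq : IsTraj step S0 (q ++ r))
    (hpq : p.getLast? = q.getLast?) : IsTraj step S0 (p ++ r) := by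
  obtain ⟨hne, hhead, hchain⟩ := hp
  obtain ⟨-, -, hqr⟩ := hq
  refine ⟨by simp [hne], fun _ => ?_, ?_⟩
  · simpa [List.head_append_of_ne_nil hne] using hhead hne
  · have hqr' := List.isChain_append.mp hqr
    exact List.isChain_append.mpr ⟨hchain, hqr'.2.1, hpq ▸ hqr'.2.2⟩

/-- A trajectory visiting more configurations than there are pairs of a state of the system and a
state of the automaton can be shortened without changing the configuration at its end. -/
theorem IsTraj.exists_shorter {S AP U : Type*} [Fintype S] [Fintype U]
    {step : S → S → Prop} {S0 : Set S} (L : S → AP) (M : DFA AP U) {τ : List S}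
    (hτ : IsTraj step S0 τ) (hlen : Fintype.card S * Fintype.card U < τ.length) :
    ∃ τ', IsTraj step S0 τ' ∧ τ'.length < τ.length ∧ τ'.getLast? = τ.getLast? ∧
      M.eval (τ'.map L) = M.eval (τ.map L) := by
  let config : Fin τ.length → S × U := fun i => (τ[i], M.eval ((τ.take (i + 1)).map L))
  have hnot : ¬ Function.Injective config := fun hinj => by
    have := Fintype.card_le_of_injective config hinj
    simp only [Fintype.card_fin, Fintype.card_prod] at this
    omega
  obtain ⟨i, j, hij, hlt⟩ : ∃ i j, config i = config j ∧ i < j := by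
    simp only [Function.Injective, not_forall] at hnot
    obtain ⟨i, j, heq, hne⟩ := hnot
    rcases lt_or_gt_of_ne hne with h | h
    exacts [⟨i, j, heq, h⟩, ⟨j, i, heq.symm, h⟩]
  obtain ⟨hstate, heval⟩ := Prod.mk.inj hij
  have hlast : (τ.take (i + 1)).getLast? = (τ.take (j + 1)).getLast? := by
    simpa [List.getLast?_take] using hstate
  have hsplit := List.take_append_drop (j + 1 : ℕ) τ
  refine ⟨τ.take (i + 1) ++ τ.drop (j + 1), ?_, ?_, ?_, ?_⟩
  · exact (hτ.take i).append_of_getLast?_eq (hsplit.symm ▸ hτ) hlast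
  · simp only [List.length_append, List.length_take, List.length_drop]
    omega
  · rw [List.getLast?_append, hlast, ← List.getLast?_append, hsplit]
  · conv_rhs => rw [← hsplit]
    simp only [DFA.eval, List.map_append, DFA.evalFrom_of_append] at heval ⊢
    rw [heval]

theorem IsTraj.exists_length_le {S AP U : Type*} [Fintype S] [Fintype U]
    {step : S → S → Prop} {S0 : Set S} (L : S → AP) (M : DFA AP U) {τ : List S}
    (hτ : IsTraj step S0 τ) :
    ∃ τ', IsTraj step S0 τ' ∧ τ'.length ≤ Fintype.card S * Fintype.card U ∧
      τ'.getLast? = τ.getLast? ∧ M.eval (τ'.map L) = M.eval (τ.map L) := by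
  induction hk : τ.length using Nat.strong_induction_on generalizing τ with
  | _ k ih =>
    by_cases hle : τ.length ≤ Fintype.card S * Fintype.card U
    · exact ⟨τ, hτ, hle, rfl, rfl⟩
    · obtain ⟨τ₁, h₁, hlt, hlast, heval⟩ := hτ.exists_shorter L M (not_le.mp hle)
      obtain ⟨τ₂, h₂, hle₂, hlast₂, heval₂⟩ := ih _ (hk ▸ hlt) h₁ rfl
      exact ⟨τ₂, h₂, hle₂, hlast₂.trans hlast, heval₂.trans heval⟩

/-- The synchronous product of two automata, with state types in arbitrary universes. -/
def DFA.sync {AP U V : Type*} (A : DFA AP U) (B : DFA AP V) : DFA AP (U × V) where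
  step q a := (A.step q.1 a, B.step q.2 a)
  start := (A.start, B.start)
  accept := A.accept ×ˢ B.accept

theorem DFA.evalFrom_sync {AP U V : Type*} (A : DFA AP U) (B : DFA AP V) (q : U × V)
    (σ : List AP) : (A.sync B).evalFrom q σ = (A.evalFrom q.1 σ, B.evalFrom q.2 σ) := by
  induction σ generalizing q with
  | nil => rfl
  | cons a σ ih => exact ih _

/-- Cycle removal in the product of the labeled transition system with the
synchronized reward machine model: every jointly reached configuration is reached
by a feasible word of length at most `|S| * m * n`. -/
theorem cycle_removal_sync {S AP UA UB : Type*}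
    [Fintype S] [Fintype AP] [Fintype UA] [Fintype UB]
    (step : S → S → Prop) (S0 : Set S) (L : S → AP)
    (m n : ℕ) (hm : Fintype.card UA = m) (hn : Fintype.card UB = n)
    (A : DFA AP UA) (B : DFA AP UB)
    (σ : List AP) (hσ : Feasible step S0 L σ) (s : S) (hs : s ∈ Reach step S0 L σ) :
    ∃ σ' : List AP, Feasible step S0 L σ' ∧ σ'.length ≤ Fintype.card S * m * n ∧
      s ∈ Reach step S0 L σ' ∧
      A.evalFrom A.start σ' = A.evalFrom A.start σ ∧
      B.evalFrom B.start σ' = B.evalFrom B.start σ := by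
  obtain ⟨τ, hτ, rfl, hlast⟩ := hs
  obtain ⟨τ', hτ', hlen, hlast', heval⟩ := hτ.exists_length_le L (A.sync B)
  simp only [DFA.eval, DFA.evalFrom_sync] at heval
  obtain ⟨hA, hB⟩ := Prod.mk.inj heval
  refine ⟨τ'.map L, ⟨τ', hτ', rfl⟩, ?_, ⟨τ', hτ', rfl, hlast'.trans hlast⟩, hA, hB⟩
  rwa [List.length_map, mul_assoc, ← hm, ← hn, ← Fintype.card_prod]
end

section
/- Let n ≥ 1, let AP be a type, and let δ : Fin n → AP → Fin n be a transition function with adjacency matrices B_a ∈ Matrix (Fin n) (Fin n) ℕ given by (B_a)_{ij} = 1 if δ(i,a) = j and 0 otherwise. For two words σ = a₁⋯a_l and σ' = a'₁⋯a'_m over AP, let v = B_{a_l}ᵀ.mulVec (⋯ (B_{a_1}ᵀ.mulVec e_u)) and v' = B_{a'_m}ᵀ.mulVec (⋯ (B_{a'_1}ᵀ.mulVec e_u)) for an initial node u ∈ Fin n, where e_u = Pi.single u 1. Then the entrywise product of v and v' is the zero vector if and only if δ*(u,σ) ≠ δ*(u,σ'). (Correctness of the negative-example Boolean constraint in the SAT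 encoding: the constraint holds exactly when the two prefixes lead to different reward machine nodes.) -/
open Matrix

/-- The extended transition function on words (Mathlib's `DFA.evalFrom`). -/
def evalStar {U AP : Type*} (δ : U → AP → U) (u : U) (w : List AP) : U :=
  w.foldl δ u

/-- Pushing a standard basis vector through the transposed adjacency matrices of a transition
function along a word yields the standard basis vector at the node reached by the word. -/
theorem foldl_transpose_mulVec_single {U R AP : Type*} [Fintype U] [DecidableEq U] [Semiring R]
    (δ : U → AP → U) (B : AP → Matrix U U R)
    (hB : ∀ a i j, B a i j = if δ i a = j then 1 else 0) (w : List AP) (u : U) :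
    w.foldl (fun v a => (B a)ᵀ.mulVec v) (Pi.single u 1) = Pi.single (evalStar δ u w) 1 := by
  induction w generalizing u with
  | nil => rfl
  | cons a w ih =>
    have hstep : (B a)ᵀ.mulVec (Pi.single u 1) = Pi.single (δ u a) 1 := by
      ext j
      simp [hB, Pi.single_apply, eq_comm]
    rw [List.foldl_cons, hstep, ih]
    rfl

/-- Correctness of the negative-example Boolean constraint in the SAT encoding:
the entrywise product of the vectors obtained by pushing a standard basis vector
through the transposed adjacency matrices along two words is the zero vector iff
the two words lead to different reward machine nodes. -/
theorem sat_encoding_negative_example {AP : Type*} (n : ℕ) (hn : 1 ≤ n)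
    (δ : Fin n → AP → Fin n) (B : AP → Matrix (Fin n) (Fin n) ℕ)
    (hB : ∀ a i j, B a i j = if δ i a = j then 1 else 0)
    (σ σ' : List AP) (u : Fin n) :
    (σ.foldl (fun v a => (B a)ᵀ.mulVec v) (Pi.single u 1)) *
      (σ'.foldl (fun v a => (B a)ᵀ.mulVec v) (Pi.single u 1)) = 0 ↔
    evalStar δ u σ ≠ evalStar δ u σ' := by
  rw [foldl_transpose_mulVec_single δ B hB, foldl_transpose_mulVec_single δ B hB]
  constructor
  · intro h heq
    have := congrFun h (evalStar δ u σ')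
    simp [heq] at this
  · intro h
    ext j
    by_cases hj : j = evalStar δ u σ
    · subst hj
      simp [h]
    · simp [Pi.single_apply, hj]
end

section
/- Let U and AP be types and let δ : U → AP → U be a non-stuttering transition function, i.e. δ(δ(u,a), a) = δ(u,a) for all u ∈ U and a ∈ AP. Then for every node u ∈ U and every word w over AP, δ*(u, w.destutter (· ≠ ·)) = δ*(u, w), where w.destutter (· ≠ ·) is the word obtained from w by collapsing every maximal run of consecutive equal letters to a single letter (Mathlib's List.destutter). (Trace compression: a non-stuttering reward machine model reaches the same node on a word and on its stutter-free compression.) -/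
/-- Folding a non-stuttering function over a list is unaffected by destuttering it. -/
theorem List.foldl_destutter'_of_nonstuttering {U AP : Type*} [DecidableEq AP]
    {δ : U → AP → U} (hns : ∀ u a, δ (δ u a) a = δ u a) (u : U) (a : AP) (w : List AP) :
    (w.destutter' (· ≠ ·) a).foldl δ u = (a :: w).foldl δ u := by
  induction w generalizing u a with
  | nil => rfl
  | cons b w ih =>
    by_cases h : a = b
    · subst h
      rw [List.destutter'_cons_neg _ (by simp), ih]
      simp [hns]
    · rw [List.destutter'_cons_pos _ h, List.foldl_cons, ih, List.foldl_cons]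
      rfl

/-- Trace compression: a non-stuttering reward machine model reaches the same node
on a word and on its stutter-free compression. -/
theorem nonstuttering_destutter {U AP : Type*} [DecidableEq AP]
    (δ : U → AP → U) (hns : ∀ u a, δ (δ u a) a = δ u a)
    (u : U) (w : List AP) :
    evalStar δ u (w.destutter (· ≠ ·)) = evalStar δ u w := by
  cases w with
  | nil => rfl
  | cons a w => exact List.foldl_destutter'_of_nonstuttering hns u a w
end

section
/- Let U and AP be types and let δ : U → AP → U be a non-stuttering transition function, i.e. δ(δ(u,a), a) = δ(u,a) for all u ∈ U and a ∈ AP. If two words w and w' over AP have the same stutter-free compression, w.destutter (· ≠ ·) = w'.destutter (· ≠ ·), then for every node u ∈ U, δ*(u, w) = δ*(u, w'). (A non-stuttering reward machine model cannot distinguish words that differ only by consecutive repetitions of the same proposition.) -/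
/-- A non-stuttering transition function evaluates a nonempty word and its stutter-free
compression to the same node. -/
theorem foldl_destutter'_ne {U AP : Type*} [DecidableEq AP] {δ : U → AP → U}
    (hns : ∀ u a, δ (δ u a) a = δ u a) (w : List AP) (a : AP) (u : U) :
    (w.destutter' (· ≠ ·) a).foldl δ u = (a :: w).foldl δ u := by
  induction w generalizing a u with
  | nil => rfl
  | cons b w ih =>
    by_cases hab : a = b
    · subst hab
      rw [List.destutter'_cons_neg _ (by simp), ih]
      simp [hns]
    · rw [List.destutter'_cons_pos _ hab, List.foldl_cons, ih, List.foldl_cons (l := b :: w)]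

/-- A non-stuttering transition function evaluates a word and its stutter-free compression to the
same node. -/
theorem foldl_destutter_ne {U AP : Type*} [DecidableEq AP] {δ : U → AP → U}
    (hns : ∀ u a, δ (δ u a) a = δ u a) (w : List AP) (u : U) :
    (w.destutter (· ≠ ·)).foldl δ u = w.foldl δ u := by
  cases w with
  | nil => rfl
  | cons a w => exact foldl_destutter'_ne hns w a u

/-- A non-stuttering reward machine model cannot distinguish words that differ
only by consecutive repetitions of the same proposition. -/
theorem nonstuttering_same_destutter {U AP : Type*} [DecidableEq AP]
    (δ : U → AP → U) (hns : ∀ u a, δ (δ u a) a = δ u a)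
    (w w' : List AP) (h : w.destutter (· ≠ ·) = w'.destutter (· ≠ ·))
    (u : U) :
    evalStar δ u w = evalStar δ u w' := by
  rw [evalStar, evalStar, ← foldl_destutter_ne hns w, h, foldl_destutter_ne hns w']
end

section
/- Let Σ be an alphabet and D a type. Let A be a deterministic finite automaton over Σ whose state type has cardinality at most m, let r be a function from A's states to D, and define π(w) = r(A.eval w) for every word w over Σ. Let B be a deterministic finite automaton over Σ whose state type has cardinality at most n, and suppose that for all words w, w' of length at most m·n, B.eval w = B.eval w' implies π(w) = π(w'). Then there exists g from B's states to D such that π(w) = g(B.eval w) for every word w over Σ of arbitrary length. (Automaton-theoretic core of Theorem 1: a function factoring through an m-state DFA factors through any n-state DFA that does not merge words of length at most m·n with different values.) -/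
/-- Every reachable state of a finite DFA is reached by a word shorter than the number of states. -/
theorem DFA.exists_length_lt_card_eval_eq {α σ : Type*} [Fintype σ] (M : DFA α σ) (x : List α) :
    ∃ y : List α, y.length < Fintype.card σ ∧ M.eval y = M.eval x := by
  induction h : x.length using Nat.strong_induction_on generalizing x with
  | _ k ih =>
    by_cases hx : x.length < Fintype.card σ
    · exact ⟨x, hx, rfl⟩
    · obtain ⟨q, a, b, c, rfl, -, hb, ha, -, hc⟩ :=
        M.evalFrom_split (not_lt.mp hx) (rfl : M.evalFrom M.start x = M.eval x)
      have hlen : (a ++ c).length < k := by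
        have := List.length_pos_iff.mpr hb
        simp only [List.length_append] at h ⊢
        omega
      obtain ⟨y, hy, hye⟩ := ih _ hlen (a ++ c) rfl
      refine ⟨y, hy, hye.trans ?_⟩
      rw [DFA.eval, DFA.evalFrom_of_append, ha, hc]

/-- The product of two automata, running them in parallel; no state is accepting. -/
def DFA.prod {α σ₁ σ₂ : Type*} (M₁ : DFA α σ₁) (M₂ : DFA α σ₂) : DFA α (σ₁ × σ₂) where
  step s a := (M₁.step s.1 a, M₂.step s.2 a)
  start := (M₁.start, M₂.start)
  accept := ∅

theorem DFA.eval_prod {α σ₁ σ₂ : Type*} (M₁ : DFA α σ₁) (M₂ : DFA α σ₂) (x : List α) :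
    (M₁.prod M₂).eval x = (M₁.eval x, M₂.eval x) := by
  induction x using List.reverseRecOn with
  | nil => rfl
  | append_singleton x a ih =>
    simp only [DFA.eval_append_singleton, ih]
    rfl

/-- Automaton-theoretic core of Theorem 1: a function `π` on words that factors
through a DFA `A` with at most `m` states factors through any DFA `B` with at most
`n` states that does not merge words of length at most `m * n` with different
`π`-values. -/
theorem factor_through_dfa {α D σA σB : Type*} [Fintype σA] [Fintype σB]
    (m n : ℕ) (hm : Fintype.card σA ≤ m) (hn : Fintype.card σB ≤ n)
    (A : DFA α σA) (r : σA → D) (π : List α → D)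
    (hπ : ∀ w, π w = r (A.eval w))
    (B : DFA α σB)
    (hsep : ∀ w w' : List α, w.length ≤ m * n → w'.length ≤ m * n →
      B.eval w = B.eval w' → π w = π w') :
    ∃ g : σB → D, ∀ w : List α, π w = g (B.eval w) := by
  have hshort (w : List α) : ∃ y : List α,
      y.length ≤ m * n ∧ A.eval y = A.eval w ∧ B.eval y = B.eval w := by
    obtain ⟨y, hy, he⟩ := (A.prod B).exists_length_lt_card_eval_eq w
    rw [Fintype.card_prod] at hy
    simp only [DFA.eval_prod, Prod.mk.injEq] at he
    exact ⟨y, hy.le.trans (Nat.mul_le_mul hm hn), he⟩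
  have hfactor : Function.FactorsThrough π B.eval := by
    intro w w' h
    obtain ⟨y, hy, hA, hB⟩ := hshort w
    obtain ⟨y', hy', hA', hB'⟩ := hshort w'
    have := hsep y y' hy hy' (by rw [hB, hB', h])
    rwa [hπ, hπ, hA, hA', ← hπ, ← hπ] at this
  exact ⟨Function.extend B.eval π fun _ ↦ r A.start, fun w ↦ (hfactor.extend_apply _ w).symm⟩
end

section
/- Let Σ be an alphabet and D a type. Let A be a deterministic finite automaton over Σ whose state type has cardinality at most m, let r be a function from A's states to D, and define π(w) = r(A.eval w) for every word w over Σ. Let B be a deterministic finite automaton over Σ whose state type has cardinality at most n. Then the following are equivalent: (i) for all words w, w' of length at most m·n, π(w) ≠ π(w') implies B.eval w ≠ B.eval w'; (ii) for all words w, w' of arbitrary length, π(w) ≠ π(w') implies B.eval w ≠ B.eval w'. (Automaton-theoretic core of Proposition 2: separating all value-distinguishing pairs of words up to length m·n is equivalent to separating all such pairs of every length.) -/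
namespace DFA

/-- Every state reachable in a finite DFA is reached by a word shorter than the number of
states. -/
theorem exists_length_lt_card_eval_eq_s16 {α σ : Type*} [Fintype σ] (M : DFA α σ) (w : List α) :
    ∃ v : List α, v.length < Fintype.card σ ∧ M.eval v = M.eval w := by
  induction h : w.length using Nat.strong_induction_on generalizing w with
  | _ k ih =>
    by_cases hw : w.length < Fintype.card σ
    · exact ⟨w, hw, rfl⟩
    obtain ⟨q, a, b, c, rfl, -, hb, ha, -, hc⟩ := M.evalFrom_split (not_lt.mp hw) rfl
    have hlen : (a ++ c).length < k := by
      have := List.length_pos_iff.mpr hb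
      simp only [List.length_append] at h ⊢
      omega
    obtain ⟨v, hv, hve⟩ := ih _ hlen (a ++ c) rfl
    refine ⟨v, hv, hve.trans ?_⟩
    rw [eval, evalFrom_of_append, ha, hc]

/-- A pair of finite DFAs can be brought into any jointly reachable pair of states by a word
shorter than the product of their numbers of states. -/
theorem exists_length_lt_card_mul_card_eval_eq {α σ₁ σ₂ : Type*} [Fintype σ₁] [Fintype σ₂]
    (M₁ : DFA α σ₁) (M₂ : DFA α σ₂) (w : List α) :
    ∃ v : List α, v.length < Fintype.card σ₁ * Fintype.card σ₂ ∧
      M₁.eval v = M₁.eval w ∧ M₂.eval v = M₂.eval w := by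
  let P : DFA α (σ₁ × σ₂) :=
    { step := fun s a => (M₁.step s.1 a, M₂.step s.2 a)
      start := (M₁.start, M₂.start)
      accept := ∅ }
  have eval_P (u : List α) : P.eval u = (M₁.eval u, M₂.eval u) := by
    induction u using List.reverseRecOn with
    | nil => rfl
    | append_singleton u a ih => simp only [eval_append_singleton, ih, P]
  obtain ⟨v, hv, he⟩ := P.exists_length_lt_card_eval_eq_s16 w
  rw [eval_P, eval_P, Prod.mk.injEq] at he
  exact ⟨v, by rwa [Fintype.card_prod] at hv, he⟩

end DFA

/-- Automaton-theoretic core of Proposition 2: for a function `π` on words that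
factors through a DFA `A` with at most `m` states, a DFA `B` with at most `n`
states separates all value-distinguishing pairs of words of length at most `m * n`
iff it separates all such pairs of every length. -/
theorem separation_bounded_iff_unbounded {α D σA σB : Type*} [Fintype σA] [Fintype σB]
    (m n : ℕ) (hm : Fintype.card σA ≤ m) (hn : Fintype.card σB ≤ n)
    (A : DFA α σA) (r : σA → D) (π : List α → D)
    (hπ : ∀ w, π w = r (A.eval w))
    (B : DFA α σB) :
    (∀ w w' : List α, w.length ≤ m * n → w'.length ≤ m * n →
      π w ≠ π w' → B.eval w ≠ B.eval w') ↔
    (∀ w w' : List α, π w ≠ π w' → B.eval w ≠ B.eval w') := by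
  refine ⟨fun h w w' hne => ?_, fun h w w' _ _ => h w w'⟩
  obtain ⟨v, hv, hvA, hvB⟩ := A.exists_length_lt_card_mul_card_eval_eq B w
  obtain ⟨v', hv', hvA', hvB'⟩ := A.exists_length_lt_card_mul_card_eval_eq B w'
  have hmn := Nat.mul_le_mul hm hn
  rw [← hvB, ← hvB']
  refine h v v' (hv.le.trans hmn) (hv'.le.trans hmn) ?_
  rwa [hπ, hπ, hvA, hvA', ← hπ, ← hπ]
end
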